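/- Let ν > -1 be a real number and let j be any positive zero of the Bessel function J_ν. Then the sum, over all positive zeros y of J_ν with y ≠ j, of 1/(y⁴ − j⁴) equals −(1/(2 j²)) · ∑_{y ∈ Z_ν} 1/(y² + j²) + (ν + 2)/(4 j⁴), where the second sum runs over all positive zeros y of J_ν (including y = j). -/

import Mathlib

/-- The Bessel function of the first kind of order `ν`, defined for `x > 0` by its series. -/
noncomputable def besselJ (ν x : ℝ) : ℝ :=
  ∑' m : ℕ, ((-1 : ℝ) ^ m / (m.factorial * Real.Gamma (m + ν + 1))) *
    (x / 2) ^ (2 * (m : ℝ) + ν)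

open Metric Filter Topology

lemma logDeriv_bound {G : ℂ → ℂ} {r A : ℝ} (hr : 0 < r) (hA : 0 < A)
    (hG : DifferentiableOn ℂ G (ball 0 r)) (hG0 : ∀ z ∈ ball (0:ℂ) r, G z ≠ 0)
    (hb : ∀ z ∈ ball (0:ℂ) r, ‖G z‖ ≤ ‖G 0‖ * Real.exp A) {a : ℂ} (ha : ‖a‖ ≤ r / 4) :
    ‖logDeriv G a‖ ≤ 8 * A / r := by
  have hd : DifferentiableOn ℂ (fun z => deriv G z / G z) (ball 0 r) :=
    (hG.deriv isOpen_ball).div hG hG0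
  obtain ⟨L, hL0, hL⟩ := hd.isExactOn_ball.with_val_at 0 0
  have h0 : (0:ℂ) ∈ ball (0:ℂ) r := mem_ball_self hr
  have hGd : ∀ z ∈ ball (0:ℂ) r, HasDerivAt G (deriv G z) z := fun z hz =>
    (hG.differentiableAt (isOpen_ball.mem_nhds hz)).hasDerivAt
  have hq : ∀ z ∈ ball (0:ℂ) r, HasDerivAt (fun z => G z * Complex.exp (-L z)) 0 z := by
    intro z hz
    have h1 := (hGd z hz).mul ((hL z hz).neg.cexp)
    convert! h1 using 1
    have := hG0 z hz
    simp only [Pi.neg_apply]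
    field_simp
    ring
  have hconst : ∀ z ∈ ball (0:ℂ) r, G z * Complex.exp (-L z) = G 0 := by
    intro z hz
    have := (convex_ball (0:ℂ) r).is_const_of_fderivWithin_eq_zero (𝕜 := ℂ)
      (f := fun z => G z * Complex.exp (-L z))
      (fun w hw => (hq w hw).differentiableAt.differentiableWithinAt)
      (fun w hw => by
        have := ((hq w hw).hasFDerivAt.hasFDerivWithinAt (s := ball 0 r)).fderivWithin
          (isOpen_ball.uniqueDiffWithinAt hw)
        rw [this]; ext; simp) hz h0
    simpa [hL0] using this
  have hre : Set.MapsTo L (ball 0 r) {z | z.re ≤ A} := by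
    intro z hz
    have h1 : G z = G 0 * Complex.exp (L z) := by
      rw [← hconst z hz, mul_assoc, ← Complex.exp_add]; simp
    have h2 := hb z hz
    rw [h1, norm_mul, Complex.norm_exp] at h2
    have h3 : 0 < ‖G 0‖ := norm_pos_iff.mpr (hG0 0 h0)
    have := le_of_mul_le_mul_left h2 h3
    exact Real.exp_le_exp.mp this
  have hLd : DifferentiableOn ℂ L (ball 0 r) := fun z hz =>
    (hL z hz).differentiableAt.differentiableWithinAt
  have hbd : ∀ z ∈ sphere a (r/4), ‖L z‖ ≤ 2 * A := by
    intro z hz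
    have hz2 : ‖z‖ ≤ r / 2 := by
      have : ‖z - a‖ = r / 4 := by simpa [dist_eq_norm] using hz
      calc ‖z‖ = ‖(z - a) + a‖ := by simp
        _ ≤ ‖z - a‖ + ‖a‖ := norm_add_le _ _
        _ ≤ r/2 := by linarith
    have hzb : z ∈ ball (0:ℂ) r := by simp; linarith
    refine (Complex.borelCaratheodory_zero hA hLd hre hr hzb hL0).trans ?_
    rw [div_le_iff₀ (by linarith)]
    nlinarith [norm_nonneg z]
  have hsub : closedBall a (r/4) ⊆ ball 0 r := by
    intro z hz
    have : ‖z - a‖ ≤ r / 4 := by simpa [dist_eq_norm] using hz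
    have : ‖z‖ ≤ r / 2 := by
      calc ‖z‖ = ‖(z - a) + a‖ := by simp
        _ ≤ ‖z - a‖ + ‖a‖ := norm_add_le _ _
        _ ≤ r/2 := by linarith
    simp; linarith
  have := Complex.norm_deriv_le_of_forall_mem_sphere_norm_le (c := a) (R := r/4) (f := L) (C := 2*A)
    (by linarith) ((hLd.mono hsub).diffContOnCl_ball subset_rfl) hbd
  have hab : a ∈ ball (0:ℂ) r := hsub (mem_closedBall_self (by linarith))
  rw [(hL a hab).deriv] at this
  rw [logDeriv_apply]
  refine this.trans (le_of_eq ?_)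
  field_simp; ring

lemma exists_quot {F : ℂ → ℂ} (hF : Differentiable ℂ F) (S : Finset ℂ)
    (hS : ∀ b ∈ S, F b = 0 ∧ b ≠ 0) :
    ∃ G : ℂ → ℂ, Differentiable ℂ G ∧ ∀ z, F z = G z * ∏ b ∈ S, (1 - z / b) := by
  classical
  induction S using Finset.induction_on with
  | empty => exact ⟨F, hF, by simp⟩
  | insert b S hb ih =>
    obtain ⟨G, hG, hFG⟩ := ih (fun c hc => hS c (Finset.mem_insert_of_mem hc))
    obtain ⟨hFb, hb0⟩ := hS b (Finset.mem_insert_self _ _)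
    have hGb : G b = 0 := by
      have := hFG b
      rw [hFb] at this
      rcases mul_eq_zero.mp this.symm with h | h
      · exact h
      · obtain ⟨c, hc, h⟩ := Finset.prod_eq_zero_iff.mp h
        have hc0 := (hS c (Finset.mem_insert_of_mem hc)).2
        have : b = c := by field_simp at h; linear_combination -h
        exact absurd (this ▸ hc) hb
    refine ⟨fun z => -b * dslope G b z, ?_, ?_⟩
    · have : Differentiable ℂ (dslope G b) := by
        rw [← differentiableOn_univ]
        exact (Complex.differentiableOn_dslope univ_mem).mpr hG.differentiableOn
      exact this.const_mul _
    · intro z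
      rw [Finset.prod_insert hb, hFG z]
      have h1 : G z = (z - b) * dslope G b z := by
        have := sub_smul_dslope G b z
        rw [hGb] at this; simpa using this.symm
      rw [h1]; field_simp; ring

lemma finite_zeros {F : ℂ → ℂ} (hF : Differentiable ℂ F) (h0 : F 0 ≠ 0) (r : ℝ) :
    {z | F z = 0 ∧ ‖z‖ ≤ r}.Finite := by
  have han : AnalyticOnNhd ℂ F Set.univ := fun z _ => hF.analyticAt z
  by_contra hinf
  obtain ⟨x, -, hx⟩ := Set.Infinite.exists_accPt_of_subset_isCompact hinf (isCompact_closedBall (0:ℂ) r)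
    (fun z hz => by simpa using hz.2)
  have hfr : ∃ᶠ z in 𝓝[≠] x, F z = 0 := by
    rw [accPt_iff_frequently_nhdsNE] at hx
    exact hx.mono fun z hz => hz.1
  have := han.eqOn_zero_of_preconnected_of_frequently_eq_zero isPreconnected_univ (Set.mem_univ x) hfr
  exact h0 (this (Set.mem_univ 0))

lemma main_limit {F : ℂ → ℂ} (hF : Differentiable ℂ F) (h0 : F 0 ≠ 0)
    (hs : ∀ z, F z = 0 → deriv F z ≠ 0)
    (hgr : ∀ ε > 0, ∃ C, ∀ z, ‖F z‖ ≤ C * Real.exp (ε * ‖z‖))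
    {a : ℂ} (ha : F a = 0) {ε : ℝ} (hε : 0 < ε) :
    ∀ᶠ r : ℝ in atTop, ∀ S : Finset ℂ, (∀ z, z ∈ S ↔ (F z = 0 ∧ ‖z‖ ≤ r) ∧ z ≠ a) →
      ‖deriv (deriv F) a / (2 * deriv F a) - ∑ z ∈ S, 1 / (a - z)‖ ≤ ε := by
  obtain ⟨C, hC⟩ := hgr (ε / 32) (by positivity)
  set B := max 1 (Real.log (C / ‖F 0‖)) with hB
  have hBpos : 0 < B := lt_max_of_lt_left one_pos
  have hF0 : 0 < ‖F 0‖ := norm_pos_iff.mpr h0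
  have hCpos : 0 < C := by
    have := hC 0
    simp at this; linarith
  have ha0 : a ≠ 0 := by rintro rfl; exact h0 ha
  filter_upwards [eventually_ge_atTop (4 * ‖a‖), eventually_gt_atTop 0,
    eventually_ge_atTop (16 * B / ε)] with r hr4 hr0 hrB S hS
  classical
  have haS : a ∉ S := fun h => ((hS a).mp h).2 rfl
  have hS' : ∀ z, z ∈ insert a S ↔ F z = 0 ∧ ‖z‖ ≤ r := by
    intro z
    rw [Finset.mem_insert, hS]
    constructor
    · rintro (rfl | h)
      · exact ⟨ha, by linarith [norm_nonneg z]⟩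
      · exact h.1
    · intro h
      by_cases hz : z = a
      · exact Or.inl hz
      · exact Or.inr ⟨h, hz⟩
  have hne0 : ∀ z ∈ insert a S, z ≠ 0 := by
    rintro z hz rfl
    exact h0 ((hS' 0).mp hz).1
  obtain ⟨G, hG, hFG⟩ := exists_quot hF (insert a S) (fun b hb => ⟨((hS' b).mp hb).1, hne0 b hb⟩)
  have hG00 : G 0 = F 0 := by rw [hFG 0]; simp
  have hPd : ∀ T : Finset ℂ, Differentiable ℂ (fun z => ∏ b ∈ T, (1 - z / b)) := by
    intro T; fun_prop
  have hGnz : ∀ z, ‖z‖ ≤ r → G z ≠ 0 := by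
    intro z hz hGz
    have hFz : F z = 0 := by rw [hFG z, hGz, zero_mul]
    have hzS := (hS' z).mpr ⟨hFz, hz⟩
    apply hs z hFz
    have hP0 : ∏ b ∈ insert a S, (1 - z / b) = 0 :=
      Finset.prod_eq_zero hzS (by rw [div_self (hne0 z hzS), sub_self])
    have : F = fun z => G z * ∏ b ∈ insert a S, (1 - z / b) := funext hFG
    rw [this, deriv_fun_mul hG.differentiableAt (hPd _).differentiableAt, hGz, hP0]
    simp
  have hsph : ∀ z ∈ sphere (0:ℂ) (2 * r), ‖G z‖ ≤ ‖G 0‖ * Real.exp (B + ε / 16 * r) := by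
    intro z hz
    have hzn : ‖z‖ = 2 * r := by simpa using hz
    have hP : 1 ≤ ‖∏ b ∈ insert a S, (1 - z / b)‖ := by
      rw [norm_prod]
      apply Finset.one_le_prod
      intro b hb
      obtain ⟨_, hb2⟩ := (hS' b).mp hb
      have hbp : 0 < ‖b‖ := norm_pos_iff.mpr (hne0 b hb)
      have h1 : 2 ≤ ‖z / b‖ := by
        rw [norm_div, le_div_iff₀ hbp, hzn]; linarith
      have h2 : ‖z / b‖ ≤ ‖1 - z / b‖ + 1 := by
        calc ‖z / b‖ = ‖1 - (1 - z / b)‖ := by congr 1; ring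
          _ ≤ ‖(1:ℂ)‖ + ‖1 - z / b‖ := norm_sub_le _ _
          _ = _ := by rw [norm_one, add_comm]
      linarith
    calc ‖G z‖ ≤ ‖G z‖ * ‖∏ b ∈ insert a S, (1 - z / b)‖ :=
          le_mul_of_one_le_right (norm_nonneg _) hP
      _ = ‖F z‖ := by rw [hFG z, norm_mul]
      _ ≤ C * Real.exp (ε / 32 * ‖z‖) := hC z
      _ ≤ ‖G 0‖ * Real.exp (B + ε / 16 * r) := by
        rw [hzn, hG00, Real.exp_add, ← mul_assoc ‖F 0‖]
        have h1 : C ≤ ‖F 0‖ * Real.exp B := by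
          rw [← div_le_iff₀' hF0]
          calc C / ‖F 0‖ = Real.exp (Real.log (C / ‖F 0‖)) := (Real.exp_log (by positivity)).symm
            _ ≤ _ := Real.exp_le_exp.mpr (le_max_right _ _)
        have h2 : ε / 32 * (2 * r) = ε / 16 * r := by ring
        rw [h2]
        gcongr
  have hball : ∀ z ∈ ball (0:ℂ) r, ‖G z‖ ≤ ‖G 0‖ * Real.exp (B + ε / 16 * r) := by
    intro z hz
    have hz' : ‖z‖ < r := by simpa using hz
    refine Complex.norm_le_of_forall_mem_frontier_norm_le (U := ball (0:ℂ) (2 * r)) isBounded_ball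
      hG.diffContOnCl ?_ (subset_closure ?_)
    · rw [frontier_ball _ (by positivity)]; exact hsph
    · simp; linarith
  have hlog := logDeriv_bound (G := G) (A := B + ε / 16 * r) hr0 (by positivity)
    hG.differentiableOn (fun z hz => hGnz z (by simpa using (mem_ball.mp hz).le)) hball
    (a := a) (by linarith)
  have hlogle : 8 * (B + ε / 16 * r) / r ≤ ε := by
    rw [div_le_iff₀ hr0]
    rw [div_le_iff₀ hε] at hrB
    linarith
  set K : ℂ → ℂ := fun z => G z * ∏ b ∈ S, (1 - z / b) with hK
  have hKd : Differentiable ℂ K := hG.mul (hPd S)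
  have hFK : F = fun z => (1 - z / a) * K z := by
    funext z; rw [hFG z, Finset.prod_insert haS, hK]; ring
  have hl : ∀ z, HasDerivAt (fun z : ℂ => 1 - z / a) (-(1 / a)) z := by
    intro z
    simpa using ((hasDerivAt_id z).div_const a).const_sub 1
  have hF1 : deriv F = fun z => -(1 / a) * K z + (1 - z / a) * deriv K z := by
    funext z
    rw [hFK]
    exact ((hl z).mul (hKd z).hasDerivAt).deriv
  have hKd' : Differentiable ℂ (deriv K) := by
    rw [← differentiableOn_univ]
    exact hKd.differentiableOn.deriv isOpen_univ
  have hF2 : deriv (deriv F) a = -(2 / a) * deriv K a := by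
    rw [hF1]
    have := ((hKd a).hasDerivAt.const_mul (-(1/a))).add ((hl a).mul (hKd' a).hasDerivAt)
    have h2 := this.deriv
    simp only [div_self ha0, sub_self, zero_mul, add_zero] at h2
    refine Eq.trans ?_ (h2.trans ?_)
    · rfl
    · ring
  have hF1a : deriv F a = -(1 / a) * K a := by
    rw [hF1]; simp [div_self ha0]
  have hKa : K a ≠ 0 := by
    intro h
    exact hs a ha (by rw [hF1a, h, mul_zero])
  have hmain : deriv (deriv F) a / (2 * deriv F a) = logDeriv K a := by
    rw [hF2, hF1a, logDeriv_apply]; field_simp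
  have hfac : ∀ b ∈ S, (1 - a / b) ≠ 0 := by
    intro b hb h
    have hb0 := hne0 b (Finset.mem_insert_of_mem hb)
    field_simp at h
    have hba : b = a := by linear_combination h
    exact haS (hba ▸ hb)
  have hlogK : logDeriv K a = logDeriv G a + ∑ z ∈ S, 1 / (a - z) := by
    rw [hK, logDeriv_mul a (hGnz a (by linarith [norm_nonneg a])) (Finset.prod_ne_zero_iff.mpr hfac)
      hG.differentiableAt (hPd S).differentiableAt]
    congr 1
    have := logDeriv_prod (s := S) (f := fun b z => 1 - z / b) (x := a) hfac
      (fun b _ => by fun_prop)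
    rw [this]
    refine Finset.sum_congr rfl fun b hb => ?_
    have hb0 := hne0 b (Finset.mem_insert_of_mem hb)
    have h1 : HasDerivAt (fun z : ℂ => 1 - z / b) (-(1 / b)) a := by
      simpa using ((hasDerivAt_id a).div_const b).const_sub 1
    rw [logDeriv_apply, h1.deriv]
    have h2 := hfac b hb
    have h3 : a - b ≠ 0 := by
      intro h; apply h2; rw [sub_eq_zero.mp h, div_self hb0, sub_self]
    rw [div_eq_div_iff h2 h3]; field_simp; ring
  rw [hmain, hlogK, add_sub_cancel_right]
  exact hlog.trans hlogle

noncomputable def pc (μ : ℝ) (m : ℕ) : ℝ := (-1) ^ m / (m.factorial * Real.Gamma (m + μ + 1))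

noncomputable def Phi (μ : ℝ) (z : ℂ) : ℂ := ∑' m : ℕ, ((pc μ m : ℝ) : ℂ) * z ^ m

lemma gpos {μ : ℝ} (hμ : -1 < μ) (m : ℕ) : 0 < Real.Gamma (m + μ + 1) :=
  Real.Gamma_pos_of_pos (by have : (0:ℝ) ≤ m := m.cast_nonneg; linarith)

lemma abs_pc {μ : ℝ} (hμ : -1 < μ) (m : ℕ) :
    |pc μ m| = 1 / (m.factorial * Real.Gamma (m + μ + 1)) := by
  have := gpos hμ m
  rw [pc, abs_div, abs_pow, abs_neg, abs_one, one_pow, abs_of_pos (by positivity)]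

lemma pc_bound {μ : ℝ} (hμ : -1 < μ) {ε : ℝ} (hε : 0 < ε) :
    ∃ C, 0 ≤ C ∧ ∀ m, |pc μ m| ≤ C * (ε ^ m / m.factorial) := by
  set b : ℕ → ℝ := fun m => (ε⁻¹) ^ m / Real.Gamma (m + μ + 1) with hb
  have hbpos : ∀ m, 0 < b m := fun m => div_pos (by positivity) (gpos hμ m)
  have hsum : Summable b := by
    refine summable_of_ratio_test_tendsto_lt_one (l := 0) one_pos
      (Eventually.of_forall fun m => (hbpos m).ne') ?_
    have h1 : ∀ m, ‖b (m+1)‖ / ‖b m‖ = ε⁻¹ / ((m:ℝ) + (μ + 1)) := by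
      intro m
      rw [Real.norm_of_nonneg (hbpos _).le, Real.norm_of_nonneg (hbpos _).le, hb]
      have hg := gpos hμ m
      have hm : (0:ℝ) < m + μ + 1 := by have : (0:ℝ) ≤ m := m.cast_nonneg; linarith
      have h2 : Real.Gamma (((m+1:ℕ):ℝ) + μ + 1) = (m + μ + 1) * Real.Gamma (m + μ + 1) := by
        rw [← Real.Gamma_add_one hm.ne']; congr 1; push_cast; ring
      have hm' : (0:ℝ) < m + (μ + 1) := by linarith
      simp only [h2]
      have hp : (0:ℝ) < ε⁻¹ ^ m := by positivity
      rw [pow_succ, show (m:ℝ) + (μ + 1) = m + μ + 1 by ring]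
      generalize ε⁻¹ ^ m = x at *
      field_simp
    simp_rw [h1]
    apply Tendsto.div_atTop tendsto_const_nhds
    exact tendsto_atTop_add_const_right _ _ tendsto_natCast_atTop_atTop
  refine ⟨∑' m, b m, tsum_nonneg fun m => (hbpos m).le, fun m => ?_⟩
  have h := hsum.le_tsum m (fun k _ => (hbpos k).le)
  have hg := gpos hμ m
  calc |pc μ m| = b m * (ε ^ m / m.factorial) := by
        rw [abs_pc hμ, hb]; simp only [inv_pow]; field_simp
    _ ≤ _ := by gcongr

lemma term_bound {μ ε C : ℝ} (hC : ∀ m, |pc μ m| ≤ C * (ε ^ m / m.factorial)) (z : ℂ) (m : ℕ) :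
    ‖((pc μ m : ℝ) : ℂ) * z ^ m‖ ≤ C * ((ε * ‖z‖) ^ m / m.factorial) := by
  rw [norm_mul, norm_pow, Complex.norm_real, Real.norm_eq_abs]
  calc _ ≤ C * (ε ^ m / m.factorial) * ‖z‖ ^ m := by gcongr; exact hC m
    _ = _ := by rw [mul_pow]; ring

lemma summable_Phi {μ : ℝ} (hμ : -1 < μ) (z : ℂ) :
    Summable fun m : ℕ => ((pc μ m : ℝ) : ℂ) * z ^ m := by
  obtain ⟨C, -, hC⟩ := pc_bound hμ one_pos
  exact Summable.of_norm_bounded ((Real.summable_pow_div_factorial _).mul_left C)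
    (term_bound hC z)

lemma Phi_growth {μ : ℝ} (hμ : -1 < μ) : ∀ ε > 0, ∃ C, ∀ z, ‖Phi μ z‖ ≤ C * Real.exp (ε * ‖z‖) := by
  intro ε hε
  obtain ⟨C, -, hC⟩ := pc_bound hμ hε
  refine ⟨C, fun z => ?_⟩
  have h := (NormedSpace.expSeries_div_hasSum_exp (ε * ‖z‖)).mul_left C
  rw [← Real.exp_eq_exp_ℝ] at h
  exact tsum_of_norm_bounded h (term_bound hC z)

lemma Phi_term_ball {μ : ℝ} (hμ : -1 < μ) (R : ℝ) : ∃ u : ℕ → ℝ, Summable u ∧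
    ∀ (m : ℕ) (w : ℂ), w ∈ ball (0:ℂ) R → ‖((pc μ m : ℝ) : ℂ) * w ^ m‖ ≤ u m := by
  obtain ⟨C, hC0, hC⟩ := pc_bound hμ one_pos
  refine ⟨fun m => C * (R ^ m / m.factorial), (Real.summable_pow_div_factorial _).mul_left C, ?_⟩
  intro m w hw
  refine (term_bound hC w m).trans ?_
  have : ‖w‖ ≤ R := by simpa using (mem_ball.mp hw).le
  rw [one_mul]
  show C * (‖w‖ ^ m / m.factorial) ≤ C * (R ^ m / m.factorial)
  gcongr

lemma Phi_diff {μ : ℝ} (hμ : -1 < μ) : Differentiable ℂ (Phi μ) := by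
  intro z
  obtain ⟨u, hu, hb⟩ := Phi_term_ball hμ (‖z‖ + 1)
  have := Complex.differentiableOn_tsum_of_summable_norm hu
    (fun m => (by fun_prop : Differentiable ℂ fun w : ℂ => ((pc μ m : ℝ) : ℂ) * w ^ m).differentiableOn)
    isOpen_ball hb
  exact this.differentiableAt (isOpen_ball.mem_nhds (by simp))

lemma pc_succ {μ : ℝ} (m : ℕ) : pc μ (m+1) * (m+1) = - pc (μ+1) m := by
  have : (((m+1:ℕ):ℝ) + μ + 1) = m + (μ + 1) + 1 := by push_cast; ring
  rw [pc, pc, this, Nat.factorial_succ, pow_succ]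
  push_cast
  have h : (m:ℝ) + 1 ≠ 0 := by positivity
  by_cases hg : Real.Gamma (m + (μ + 1) + 1) = 0
  · simp [hg]
  have hf : (m.factorial : ℝ) ≠ 0 := by positivity
  field_simp

lemma Phi_deriv {μ : ℝ} (hμ : -1 < μ) : deriv (Phi μ) = fun z => - Phi (μ + 1) z := by
  funext z
  obtain ⟨u, hu, hb⟩ := Phi_term_ball hμ (‖z‖ + 1)
  have h := Complex.hasSum_deriv_of_summable_norm hu
    (fun m => (by fun_prop : Differentiable ℂ fun w : ℂ => ((pc μ m : ℝ) : ℂ) * w ^ m).differentiableOn)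
    isOpen_ball hb (z := z) (by simp)
  have h1 : deriv (Phi μ) z = ∑' m : ℕ, deriv (fun w : ℂ => ((pc μ m : ℝ) : ℂ) * w ^ m) z :=
    h.tsum_eq.symm
  rw [h1, h.summable.tsum_eq_zero_add]
  simp only [pow_zero, mul_one, deriv_const, zero_add]
  rw [Phi, ← tsum_neg]
  congr 1
  funext m
  rw [deriv_const_mul _ (by fun_prop)]
  simp only [deriv_pow_field, Nat.add_sub_cancel]
  have := congrArg (fun x : ℝ => (x:ℂ)) (pc_succ (μ := μ) m)
  push_cast at this ⊢
  linear_combination (z ^ m) * this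

lemma Phi_hasDeriv {μ : ℝ} (hμ : -1 < μ) (z : ℂ) : HasDerivAt (Phi μ) (- Phi (μ + 1) z) z := by
  have := (Phi_diff hμ z).hasDerivAt
  rwa [Phi_deriv hμ] at this

lemma pc_rec {μ : ℝ} (hμ : -1 < μ) (m : ℕ) : pc μ m = (m + μ + 1) * pc (μ+1) m := by
  have hm : (0:ℝ) < m + μ + 1 := by have : (0:ℝ) ≤ m := m.cast_nonneg; linarith
  have h2 : Real.Gamma ((m:ℝ) + (μ + 1) + 1) = (m + μ + 1) * Real.Gamma (m + μ + 1) := by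
    rw [← Real.Gamma_add_one hm.ne']; congr 1; ring
  have hg := gpos hμ m
  rw [pc, pc, h2]
  field_simp

lemma Phi_rec {μ : ℝ} (hμ : -1 < μ) (z : ℂ) :
    z * Phi (μ + 2) z = (μ + 1) * Phi (μ + 1) z - Phi μ z := by
  have s0 := summable_Phi hμ z
  have s1 := summable_Phi (μ := μ + 1) (by linarith) z
  have s2 := summable_Phi (μ := μ + 2) (by linarith) z
  have hL : Summable fun m : ℕ => ((μ:ℂ) + 1) * (((pc (μ+1) m : ℝ) : ℂ) * z ^ m) - ((pc μ m : ℝ) : ℂ) * z ^ m :=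
    (s1.mul_left _).sub s0
  rw [Phi, Phi, Phi, ← tsum_mul_left, ← tsum_mul_left, ← (s1.mul_left _).tsum_sub s0,
    hL.tsum_eq_zero_add]
  have h0 := congrArg (fun x : ℝ => (x:ℂ)) (pc_rec hμ 0)
  push_cast at h0
  have h00 : ((μ:ℂ) + 1) * (((pc (μ+1) 0 : ℝ) : ℂ) * z ^ 0) - ((pc μ 0 : ℝ) : ℂ) * z ^ 0 = 0 := by
    rw [h0]; ring
  rw [h00, zero_add]
  congr 1
  funext m
  have h1 := congrArg (fun x : ℝ => (x:ℂ)) (pc_rec hμ (m+1))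
  have h2 := congrArg (fun x : ℝ => (x:ℂ)) (pc_succ (μ := μ + 1) m)
  rw [show μ + 1 + 1 = μ + 2 by ring] at h2
  push_cast at h1 h2
  rw [h1]
  linear_combination z ^ (m+1) * h2

lemma Phi_zero_ne {μ : ℝ} (hμ : -1 < μ) : Phi μ 0 ≠ 0 := by
  have : Phi μ 0 = ((pc μ 0 : ℝ) : ℂ) := by
    rw [Phi, tsum_eq_single 0 (by intro m hm; simp [hm])]; simp
  rw [this]
  have h := gpos hμ 0
  have : pc μ 0 ≠ 0 := by
    rw [pc]; positivity
  exact_mod_cast this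

lemma Phi_simple {μ : ℝ} (hμ : -1 < μ) (a : ℂ) (ha : Phi μ a = 0) : deriv (Phi μ) a ≠ 0 := by
  intro h
  rw [Phi_deriv hμ] at h
  replace h : Phi (μ + 1) a = 0 := by simpa using h
  have ha0 : a ≠ 0 := by rintro rfl; exact Phi_zero_ne hμ ha
  have hall : ∀ n : ℕ, Phi (μ + n) a = 0 ∧ Phi (μ + n + 1) a = 0 := by
    intro n
    induction n with
    | zero => simpa using ⟨ha, h⟩
    | succ n ih =>
      have h1 := Phi_rec (μ := μ + n) (by have : (0:ℝ) ≤ n := n.cast_nonneg; linarith) a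
      rw [ih.1, ih.2] at h1
      have h2 : Phi (μ + n + 2) a = 0 := by
        simpa [ha0] using h1
      constructor
      · rw [← ih.2]; congr 1; push_cast; ring
      · rw [← h2]; congr 1; push_cast; ring
  have hit : ∀ n : ℕ, iteratedDeriv n (Phi μ) = fun z => (-1) ^ n * Phi (μ + n) z := by
    intro n
    induction n with
    | zero => simp
    | succ n ih =>
      funext z
      rw [iteratedDeriv_succ, ih]
      have := (Phi_hasDeriv (μ := μ + n) (by have : (0:ℝ) ≤ n := n.cast_nonneg; linarith) z).const_mul
        ((-1:ℂ) ^ n)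
      rw [this.deriv, pow_succ, show μ + (n:ℝ) + 1 = μ + ((n+1 : ℕ):ℝ) by push_cast; ring]
      ring
  have := Complex.taylorSeries_eq_of_entire' (f := Phi μ) a 0 (Phi_diff hμ)
  apply Phi_zero_ne hμ
  rw [← this]
  simp [hit, (hall _).1]

lemma Phi_zero_real {ν : ℝ} (hν : -1 < ν) (a : ℂ) (ha : Phi ν a = 0) : a.im = 0 := by
  by_contra him
  set p : ℝ → ℂ := fun t => Phi ν (a * t) with hp
  set q : ℝ → ℂ := fun t => Phi (ν + 1) (a * t) with hq
  have hlin : ∀ t : ℝ, HasDerivAt (fun t : ℝ => a * (t:ℂ)) a t := by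
    intro t
    simpa using (Complex.ofRealCLM.hasDerivAt (x := t)).const_mul a
  have hpd : ∀ t, HasDerivAt p (-q t * a) t := by
    intro t
    exact (Phi_hasDeriv hν (a * t)).comp t (hlin t)
  have hqd : ∀ t : ℝ, HasDerivAt q (-Phi (ν + 1 + 1) (a * t) * a) t := by
    intro t
    exact (Phi_hasDeriv (μ := ν + 1) (by linarith) (a * t)).comp t (hlin t)
  have hrec : ∀ t : ℝ, (t:ℂ) * (-Phi (ν + 1 + 1) (a * t) * a) = p t - (ν + 1) * q t := by
    intro t
    have := Phi_rec hν (a * t)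
    rw [show ν + 1 + 1 = ν + 2 by ring]
    linear_combination -this
  set k : ℝ → ℂ := fun t => a * q t * (starRingEnd ℂ) (p t) with hk
  set k' : ℝ → ℂ := fun t => a * (-Phi (ν + 1 + 1) (a * t) * a) * (starRingEnd ℂ) (p t)
    + a * q t * (starRingEnd ℂ) (-q t * a) with hk'
  have hkd : ∀ t, HasDerivAt k (k' t) t := by
    intro t
    have h1 : HasDerivAt (fun t => (starRingEnd ℂ) (p t)) ((starRingEnd ℂ) (-q t * a)) t := by
      simpa using (hpd t).star
    exact ((hqd t).const_mul a).mul h1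
  have hkim : ∀ t, HasDerivAt (fun t => (k t).im) (k' t).im t := fun t =>
    Complex.imCLM.hasFDerivAt.comp_hasDerivAt t (hkd t)
  set w : ℝ → ℝ := fun t => a.im * (t ^ (ν + 1) * (k t).im) with hw
  have hwd : ∀ t, 0 < t → HasDerivAt w (t ^ ν * (a.im) ^ 2 * Complex.normSq (p t)) t := by
    intro t ht
    have h1 := ((Real.hasDerivAt_rpow_const (x := t) (p := ν + 1) (Or.inl ht.ne')).mul (hkim t)).const_mul a.im
    convert! h1 using 1
    have h2 : t ^ (ν + 1) = t ^ ν * t := by rw [Real.rpow_add ht, Real.rpow_one]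
    have h3 : (t:ℂ) * k' t = a * (p t - (ν + 1) * q t) * (starRingEnd ℂ) (p t)
        - t * (a * q t * (starRingEnd ℂ) (a * q t)) := by
      rw [hk']; simp only [← hrec]; simp only [map_mul, map_neg]; ring
    have h4 : t * (k' t).im = a.im * Complex.normSq (p t) - (ν + 1) * (k t).im := by
      have := congrArg Complex.im h3
      rw [Complex.im_ofReal_mul] at this
      rw [this, Complex.mul_conj, mul_sub, sub_mul, Complex.sub_im, Complex.sub_im, mul_assoc a (p t), Complex.mul_conj]
      have e1 : (a * ((ν + 1) * q t) * (starRingEnd ℂ) (p t)) = ((ν + 1 : ℝ):ℂ) * k t := by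
        rw [hk]; push_cast; ring
      rw [e1, Complex.im_ofReal_mul, Complex.im_mul_ofReal, Complex.im_ofReal_mul, Complex.ofReal_im]
      ring
    rw [h2, add_sub_cancel_right]
    linear_combination (-(a.im * t ^ ν)) * h4
  have hwc : ContinuousOn w (Set.Icc 0 1) := by
    have hkc : Continuous fun t => (k t).im :=
      continuous_iff_continuousAt.mpr fun t => (hkim t).continuousAt
    have : Continuous fun t : ℝ => t ^ (ν + 1) := Real.continuous_rpow_const (by linarith)
    exact (continuous_const.mul (this.mul hkc)).continuousOn
  have hmono : MonotoneOn w (Set.Icc 0 1) := by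
    apply monotoneOn_of_deriv_nonneg (convex_Icc 0 1) hwc
    · intro t ht
      rw [interior_Icc] at ht
      exact (hwd t ht.1).differentiableAt.differentiableWithinAt
    · intro t ht
      rw [interior_Icc] at ht
      rw [(hwd t ht.1).deriv]
      have := Real.rpow_nonneg ht.1.le ν
      have := Complex.normSq_nonneg (p t)
      positivity
  have hw0 : w 0 = 0 := by
    simp [hw, Real.zero_rpow (by linarith : ν + 1 ≠ 0)]
  have hw1 : w 1 = 0 := by
    simp [hw, hk, hp, ha]
  have hwz : ∀ t ∈ Set.Icc (0:ℝ) 1, w t = 0 := by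
    intro t ht
    apply le_antisymm
    · rw [← hw1]; exact hmono ht (by simp) ht.2
    · rw [← hw0]; exact hmono (by simp) ht ht.1
  have hpz : ∀ t ∈ Set.Ioo (0:ℝ) 1, p t = 0 := by
    intro t ht
    have h1 : w =ᶠ[𝓝 t] fun _ => 0 := by
      filter_upwards [Ioo_mem_nhds ht.1 ht.2] with s hs
      exact hwz s ⟨hs.1.le, hs.2.le⟩
    have h2 := (hwd t ht.1).unique ((hasDerivAt_const t (0:ℝ)).congr_of_eventuallyEq h1)
    have h3 := (Real.rpow_pos_of_pos ht.1 ν).ne'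
    simpa [h3, him] using h2
  have hpc : Tendsto p (𝓝[>] 0) (𝓝 (p 0)) := (hpd 0).continuousAt.tendsto.mono_left nhdsWithin_le_nhds
  have hp0 : p 0 = 0 := by
    refine tendsto_nhds_unique hpc (tendsto_const_nhds.congr' ?_)
    filter_upwards [Ioo_mem_nhdsGT (one_pos : (0:ℝ) < 1)] with t ht
    exact (hpz t ht).symm
  exact Phi_zero_ne hν (by simpa [hp] using hp0)

noncomputable def phiR (μ t : ℝ) : ℝ := ∑' m : ℕ, pc μ m * t ^ m

lemma Phi_ofReal (μ t : ℝ) : Phi μ (t:ℂ) = (phiR μ t : ℂ) := by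
  rw [Phi, phiR, Complex.ofReal_tsum]; push_cast; rfl

lemma Phi_zero_pos {ν : ℝ} (hν : -1 < ν) (a : ℂ) (ha : Phi ν a = 0) : ∃ x : ℝ, 0 < x ∧ a = x := by
  have him := Phi_zero_real hν a ha
  have hax : a = (a.re : ℂ) := by apply Complex.ext <;> simp [him]
  refine ⟨a.re, ?_, hax⟩
  by_contra hneg
  push Not at hneg
  rw [hax, Phi_ofReal] at ha
  have ha' : phiR ν a.re = 0 := by exact_mod_cast ha
  have hs : Summable fun m : ℕ => pc ν m * a.re ^ m := by
    have := summable_Phi hν (a.re : ℂ)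
    exact_mod_cast this
  have hnn : ∀ m, 0 ≤ pc ν m * a.re ^ m := by
    intro m
    have : pc ν m * a.re ^ m = (-a.re) ^ m / (m.factorial * Real.Gamma (m + ν + 1)) := by
      rw [pc, neg_pow a.re]; ring
    rw [this]
    have := gpos hν m
    have : 0 ≤ -a.re := by linarith
    positivity
  have h1 := hs.le_tsum 0 (fun m _ => hnn m)
  have h2 : 0 < pc ν 0 * a.re ^ 0 := by
    have := gpos hν 0
    rw [pc]; positivity
  rw [phiR] at ha'
  linarith


lemma besselJ_eq (ν : ℝ) {x : ℝ} (hx : 0 < x) :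
    besselJ ν x = (x / 2) ^ ν * phiR ν (x ^ 2 / 4) := by
  rw [besselJ, phiR, ← tsum_mul_left]
  congr 1
  funext m
  have hx2 : 0 < x / 2 := by positivity
  rw [Real.rpow_add hx2, show (2 * (m:ℝ)) = ((2 * m : ℕ) : ℝ) by push_cast; ring,
    Real.rpow_natCast, pow_mul, pc, show (x / 2) ^ 2 = x ^ 2 / 4 by ring]
  ring

lemma besselJ_zero_iff (ν : ℝ) {x : ℝ} (hx : 0 < x) :
    besselJ ν x = 0 ↔ Phi ν ((x ^ 2 / 4 : ℝ) : ℂ) = 0 := by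
  rw [besselJ_eq ν hx, Phi_ofReal, Complex.ofReal_eq_zero, mul_eq_zero]
  have := (Real.rpow_pos_of_pos (by positivity : 0 < x / 2) ν).ne'
  simp [this]

lemma hasSum_of_exhaust {ι : Type*} {f : ι → ℝ} {T : ℝ → Finset ι} {c r0 : ℝ}
    (hmono : Monotone T) (hex : ∀ i, ∃ r, i ∈ T r) (hnn : ∀ i, i ∉ T r0 → 0 ≤ f i)
    (hlim : Tendsto (fun r => ∑ i ∈ T r, f i) atTop (𝓝 c)) : HasSum f c := by
  classical
  have hT : Tendsto T atTop atTop := tendsto_atTop_finset_of_monotone hmono hex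
  set g : ι → ℝ := fun i => if i ∈ T r0 then 0 else f i with hg
  have hg0 : ∀ i, 0 ≤ g i := by
    intro i
    by_cases h : i ∈ T r0
    · simp [hg, h]
    · simpa [hg, h] using hnn i h
  have hgs : ∀ r, r0 ≤ r → ∑ i ∈ T r, g i = ∑ i ∈ T r, f i - ∑ i ∈ T r0, f i := by
    intro r hr
    rw [eq_sub_iff_add_eq, ← Finset.sum_sdiff (hmono hr), ← Finset.sum_sdiff (hmono hr) (f := f)]
    have h1 : ∑ i ∈ T r0, g i = 0 := Finset.sum_eq_zero fun i hi => by simp [hg, hi]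
    have h2 : ∑ i ∈ T r \ T r0, g i = ∑ i ∈ T r \ T r0, f i :=
      Finset.sum_congr rfl fun i hi => by simp [hg, (Finset.mem_sdiff.mp hi).2]
    rw [h1, h2, add_zero]
  have hglim : Tendsto (fun r => ∑ i ∈ T r, g i) atTop (𝓝 (c - ∑ i ∈ T r0, f i)) := by
    refine (hlim.sub_const _).congr' ?_
    filter_upwards [eventually_ge_atTop r0] with r hr
    exact (hgs r hr).symm
  have hgm : Monotone fun r => ∑ i ∈ T r, g i := fun r s hrs =>
    Finset.sum_le_sum_of_subset_of_nonneg (hmono hrs) fun i _ _ => hg0 i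
  have hgsum : Summable g := by
    refine summable_of_sum_le (c := c - ∑ i ∈ T r0, f i) hg0 fun u => ?_
    obtain ⟨r, hr⟩ := (hT.eventually (eventually_ge_atTop u)).exists
    exact (Finset.sum_le_sum_of_subset_of_nonneg hr fun i _ _ => hg0 i).trans
      (hgm.ge_of_tendsto hglim r)
  have hfsum : Summable f := by
    refine hgsum.congr_cofinite ?_
    filter_upwards [(T r0).finite_toSet.compl_mem_cofinite] with i hi
    have : i ∉ T r0 := by simpa using hi
    simp [hg, this]
  have := hfsum.hasSum.comp hT
  rw [← tendsto_nhds_unique this hlim]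
  exact hfsum.hasSum

lemma calogero (ν : ℝ) (hν : -1 < ν) (j : ℝ) (hj : 0 < j) (hjz : besselJ ν j = 0) :
    HasSum (fun y : {y : ℝ // 0 < y ∧ besselJ ν y = 0 ∧ y ≠ j} => (1:ℝ) / ((y:ℝ) ^ 2 - j ^ 2))
      ((ν + 1) / (2 * j ^ 2)) := by
  classical
  set Y := {y : ℝ // 0 < y ∧ besselJ ν y = 0 ∧ y ≠ j}
  set a : ℂ := ((j ^ 2 / 4 : ℝ) : ℂ) with ha
  have haz : Phi ν a = 0 := (besselJ_zero_iff ν hj).mp hjz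
  have hfin := finite_zeros (Phi_diff hν) (Phi_zero_ne hν)
  set S : ℝ → Finset ℂ := fun r => (hfin r).toFinset.filter (· ≠ a) with hS
  have hSm : ∀ r z, z ∈ S r ↔ (Phi ν z = 0 ∧ ‖z‖ ≤ r) ∧ z ≠ a := by
    intro r z; simp [hS]
  set e : Y → ℂ := fun y => (((y:ℝ) ^ 2 / 4 : ℝ) : ℂ) with he
  have hinj : Function.Injective e := by
    intro x y hxy
    have h1 : (x:ℝ) ^ 2 / 4 = (y:ℝ) ^ 2 / 4 := by
      exact Complex.ofReal_injective hxy
    have h2 : (x:ℝ) ^ 2 = (y:ℝ) ^ 2 := by linarith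
    exact Subtype.ext ((pow_left_inj₀ x.2.1.le y.2.1.le two_ne_zero).mp h2)
  have hez : ∀ y, Phi ν (e y) = 0 := fun y => (besselJ_zero_iff ν y.2.1).mp y.2.2.1
  have hea : ∀ y, e y ≠ a := by
    intro y h
    have h1 : (y:ℝ) ^ 2 / 4 = j ^ 2 / 4 := Complex.ofReal_injective h
    have h2 : (y:ℝ) ^ 2 = j ^ 2 := by linarith
    exact y.2.2.2 ((pow_left_inj₀ y.2.1.le hj.le two_ne_zero).mp h2)
  have hsurj : ∀ z, Phi ν z = 0 → z ≠ a → ∃ y, e y = z := by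
    intro z hz hza
    obtain ⟨x, hx, rfl⟩ := Phi_zero_pos hν z hz
    have h4 : (2 * √x) ^ 2 / 4 = x := by rw [mul_pow, Real.sq_sqrt hx.le]; ring
    have hpos : 0 < 2 * √x := by positivity
    refine ⟨⟨2 * √x, hpos, (besselJ_zero_iff ν hpos).mpr (by rw [h4]; exact hz), ?_⟩, ?_⟩
    · intro h; apply hza; rw [ha, ← h, h4]
    · simp only [he, h4]
  set T : ℝ → Finset Y := fun r => (S r).preimage e hinj.injOn with hT
  have hTm : ∀ r y, y ∈ T r ↔ ‖e y‖ ≤ r := by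
    intro r y
    rw [hT, Finset.mem_preimage, hSm]
    simp [hez y, hea y]
  have hsum : ∀ r, ∑ z ∈ S r, 1 / (a - z)
      = ((-4 * ∑ y ∈ T r, (1:ℝ) / ((y:ℝ) ^ 2 - j ^ 2) : ℝ) : ℂ) := by
    intro r
    rw [hT, ← Finset.sum_preimage e (S r) hinj.injOn (fun z => 1 / (a - z)), Finset.mul_sum]
    · push_cast
      refine Finset.sum_congr rfl fun y _ => ?_
      have h3 : (y:ℝ) ^ 2 - j ^ 2 ≠ 0 := by
        intro h
        exact y.2.2.2 ((pow_left_inj₀ y.2.1.le hj.le two_ne_zero).mp (by linarith))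
      have h3' : ((y:ℝ):ℂ) ^ 2 - (j:ℂ) ^ 2 ≠ 0 := by exact_mod_cast h3
      have h4 : a - e y = -(((y:ℝ):ℂ) ^ 2 - (j:ℂ) ^ 2) / 4 := by
        simp only [ha, he]; push_cast; ring
      rw [h4]
      field_simp
    · intro z hz hz2
      rw [hSm] at hz
      exact absurd (hsurj z hz.1.1 hz.2) (by simpa using hz2)
  have hj0 : (j:ℂ) ≠ 0 := by exact_mod_cast hj.ne'
  have ha4 : a = (j:ℂ) ^ 2 / 4 := by rw [ha]; push_cast; ring
  have ha0 : a ≠ 0 := by rw [ha4]; exact div_ne_zero (pow_ne_zero 2 hj0) (by norm_num)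
  have hval : deriv (deriv (Phi ν)) a / (2 * deriv (Phi ν) a) =
      ((-4 * ((ν + 1) / (2 * j ^ 2)) : ℝ) : ℂ) := by
    have hs := Phi_simple hν a haz
    have hd2 : deriv (deriv (Phi ν)) a = Phi (ν + 2) a := by
      rw [Phi_deriv hν]
      have := (Phi_hasDeriv (μ := ν + 1) (by linarith) a).neg
      rw [show ν + 1 + 1 = ν + 2 by ring, neg_neg] at this
      exact this.deriv
    have hr := Phi_rec hν a
    rw [haz, sub_zero] at hr
    rw [hd2]
    rw [Phi_deriv hν] at hs ⊢
    simp only at hs ⊢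
    have hs' : Phi (ν + 1) a ≠ 0 := by simpa using hs
    have hp : Phi (ν + 2) a = (ν + 1) * Phi (ν + 1) a / a := by
      rw [eq_div_iff ha0, ← hr]; ring
    rw [hp, ha4]
    push_cast
    rw [← ha4] 
    field_simp
    rw [ha4]
    ring
  refine hasSum_of_exhaust (T := T) (r0 := j ^ 2 / 4) ?_ ?_ ?_ ?_
  · intro r s hrs y hy
    rw [hTm] at hy ⊢
    exact hy.trans hrs
  · exact fun y => ⟨‖e y‖, (hTm _ y).mpr le_rfl⟩
  · intro y hy
    rw [hTm, not_le] at hy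
    have : ‖e y‖ = (y:ℝ) ^ 2 / 4 := by
      simp only [he]
      rw [Complex.norm_real, Real.norm_of_nonneg (by positivity)]
    rw [this] at hy
    apply div_nonneg zero_le_one
    linarith
  · rw [Metric.tendsto_nhds]
    intro ε hε
    filter_upwards [main_limit (Phi_diff hν) (Phi_zero_ne hν) (Phi_simple hν) (Phi_growth hν) haz
      hε] with r hr
    have h := hr (S r) (hSm r)
    rw [hval, hsum, ← Complex.ofReal_sub, Complex.norm_real, Real.norm_eq_abs, ← mul_sub, abs_mul,
      abs_sub_comm] at h
    rw [Real.dist_eq]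
    norm_num at h ⊢
    linarith

theorem quartic_bessel_zero_identity (ν : ℝ) (hν : -1 < ν) (j : ℝ) (hj : 0 < j)
    (hjz : besselJ ν j = 0) :
    ∑' y : {y : ℝ // 0 < y ∧ besselJ ν y = 0 ∧ y ≠ j},
        (1 : ℝ) / ((y : ℝ) ^ 4 - j ^ 4)
      = -(1 / (2 * j ^ 2)) *
          (∑' y : {y : ℝ // 0 < y ∧ besselJ ν y = 0}, (1 : ℝ) / ((y : ℝ) ^ 2 + j ^ 2))
        + (ν + 2) / (4 * j ^ 4) := by
  have hf := calogero ν hν j hj hjz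
  have hne : ∀ y : {y : ℝ // 0 < y ∧ besselJ ν y = 0 ∧ y ≠ j}, (y:ℝ) ^ 2 - j ^ 2 ≠ 0 := by
    intro y h
    exact y.2.2.2 ((pow_left_inj₀ y.2.1.le hj.le two_ne_zero).mp (by linarith))
  have hh : Summable (fun y : {y : ℝ // 0 < y ∧ besselJ ν y = 0 ∧ y ≠ j} =>
      (1:ℝ) / ((y:ℝ) ^ 2 + j ^ 2)) := by
    refine Summable.of_norm_bounded hf.summable.abs fun y => ?_
    have h1 : 0 < (y:ℝ) ^ 2 + j ^ 2 := by positivity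
    rw [Real.norm_of_nonneg (by positivity), abs_div, abs_one]
    apply one_div_le_one_div_of_le (abs_pos.mpr (hne y))
    rw [abs_le]
    constructor <;> nlinarith [sq_nonneg (y:ℝ), sq_nonneg j]
  have hsplit : ∑' y : {y : ℝ // 0 < y ∧ besselJ ν y = 0}, (1 : ℝ) / ((y : ℝ) ^ 2 + j ^ 2)
      = (∑' y : {y : ℝ // 0 < y ∧ besselJ ν y = 0 ∧ y ≠ j}, (1 : ℝ) / ((y : ℝ) ^ 2 + j ^ 2))
        + 1 / (j ^ 2 + j ^ 2) := by
    set A : Set ℝ := {y | 0 < y ∧ besselJ ν y = 0 ∧ y ≠ j}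
    set A0 : Set ℝ := {y | 0 < y ∧ besselJ ν y = 0}
    have hA : A0 = A ∪ {j} := by
      ext y
      constructor
      · intro hy
        by_cases h : y = j
        · exact Or.inr h
        · exact Or.inl ⟨hy.1, hy.2, h⟩
      · rintro (h | h)
        · exact ⟨h.1, h.2.1⟩
        · rw [Set.mem_singleton_iff.mp h]; exact ⟨hj, hjz⟩
    have hdis : Disjoint A {j} := by
      rw [Set.disjoint_singleton_right]
      exact fun h => h.2.2 rfl
    change ∑' y : A0, (fun x : ℝ => (1:ℝ) / (x ^ 2 + j ^ 2)) y =
      (∑' y : A, (fun x : ℝ => (1:ℝ) / (x ^ 2 + j ^ 2)) y) + _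
    rw [hA, Summable.tsum_union_disjoint (f := fun x : ℝ => (1:ℝ) / (x ^ 2 + j ^ 2)) hdis hh
      ((Set.finite_singleton j).summable _), tsum_singleton j (fun x : ℝ => (1:ℝ) / (x ^ 2 + j ^ 2))]
  have hterm : ∀ y : {y : ℝ // 0 < y ∧ besselJ ν y = 0 ∧ y ≠ j},
      (1 : ℝ) / ((y : ℝ) ^ 4 - j ^ 4) = 1 / (2 * j ^ 2) *
        (1 / ((y:ℝ) ^ 2 - j ^ 2) - 1 / ((y:ℝ) ^ 2 + j ^ 2)) := by
    intro y
    have h1 : (y:ℝ) ^ 2 + j ^ 2 ≠ 0 := by positivity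
    have h2 := hne y
    rw [show (y:ℝ) ^ 4 - j ^ 4 = ((y:ℝ) ^ 2 - j ^ 2) * ((y:ℝ) ^ 2 + j ^ 2) by ring]
    field_simp
    ring
  rw [hsplit, tsum_congr hterm, tsum_mul_left, hf.summable.tsum_sub hh, hf.tsum_eq]
  field_simp
  ring
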